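/- arXiv:2406.15180 — 3 statements merged into one kernel-verified Lean document; each statement's English description precedes it below -/
import Mathlib

section
/- There is a universal constant C ≥ 1 such that for every n ≥ 2 and every monotone symmetric norm N on ℝⁿ, there exists a monotone norm M on ℝⁿ that is (C·log₂ n)-supermodular and satisfies N(x) ≤ M(x) ≤ C·(log₂ n)·N(x) for all x ∈ ℝⁿ with nonnegative coordinates. -/
noncomputable section

/-- A monotone norm on ℝⁿ: subadditive, absolutely homogeneous, point-separating, and
monotone on the nonnegative orthant. -/
def IsMonotoneNorm {n : ℕ} (N : (Fin n → ℝ) → ℝ) : Prop :=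
  (∀ x y, N (x + y) ≤ N x + N y) ∧
  (∀ (c : ℝ) (x), N (c • x) = |c| * N x) ∧
  (∀ x, N x = 0 → x = 0) ∧
  (∀ x y : Fin n → ℝ, 0 ≤ x → x ≤ y → N x ≤ N y)

/-- `N` is `p`-supermodular: `N(u+v+w)^p − N(u+v)^p ≥ N(u+w)^p − N(u)^p` for all
nonnegative `u, v, w`. -/
def IsPSupermodular {n : ℕ} (N : (Fin n → ℝ) → ℝ) (p : ℝ) : Prop :=
  ∀ u v w : Fin n → ℝ, 0 ≤ u → 0 ≤ v → 0 ≤ w →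
    N (u + w) ^ p - N u ^ p ≤ N (u + v + w) ^ p - N (u + v) ^ p

/-- A symmetric norm: invariant under permutations of the coordinates. -/
def IsSymmetricNorm {n : ℕ} (N : (Fin n → ℝ) → ℝ) : Prop :=
  ∀ (σ : Equiv.Perm (Fin n)) (x : Fin n → ℝ), N (x ∘ σ) = N x


namespace SupApprox

structure Good {n : ℕ} (p : ℝ) (F : (Fin n → ℝ) → ℝ) : Prop where
  nonneg : ∀ x, 0 ≤ x → 0 ≤ F x
  mono : ∀ x y, 0 ≤ x → x ≤ y → F x ≤ F y
  hom : ∀ (c : ℝ) x, 0 < c → 0 ≤ x → F (c • x) = c ^ p * F x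
  conv : ∀ (a b : ℝ) x y, 0 ≤ x → 0 ≤ y → 0 ≤ a → 0 ≤ b → a + b = 1 →
    F (a • x + b • y) ≤ a * F x + b * F y
  smod : ∀ u v w, 0 ≤ u → 0 ≤ v → 0 ≤ w → F (u + w) + F (u + v) ≤ F (u + v + w) + F u

lemma Good.sum {n : ℕ} {p : ℝ} {ι : Type*} (s : Finset ι) (c : ι → ℝ)
    (F : ι → (Fin n → ℝ) → ℝ) (hc : ∀ j, 0 ≤ c j) (hF : ∀ j ∈ s, Good p (F j)) :
    Good p (fun x => ∑ j ∈ s, c j * F j x) where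
  nonneg x hx := Finset.sum_nonneg fun j hj => mul_nonneg (hc j) ((hF j hj).nonneg x hx)
  mono x y hx hy := Finset.sum_le_sum fun j hj =>
    mul_le_mul_of_nonneg_left ((hF j hj).mono x y hx hy) (hc j)
  hom a x ha hx := by
    simp only [Finset.mul_sum]
    refine Finset.sum_congr rfl fun j hj => ?_
    rw [(hF j hj).hom a x ha hx]; ring
  conv a b x y hx hy ha hb hab := by
    simp only [Finset.mul_sum]
    rw [← Finset.sum_add_distrib]
    refine Finset.sum_le_sum fun j hj => ?_
    have := mul_le_mul_of_nonneg_left ((hF j hj).conv a b x y hx hy ha hb hab) (hc j)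
    linarith
  smod u v w hu hv hw := by
    rw [← Finset.sum_add_distrib, ← Finset.sum_add_distrib]
    refine Finset.sum_le_sum fun j hj => ?_
    have := mul_le_mul_of_nonneg_left ((hF j hj).smod u v w hu hv hw) (hc j)
    linarith

def toNorm {n : ℕ} (p : ℝ) (F : (Fin n → ℝ) → ℝ) (x : Fin n → ℝ) : ℝ := (F |x|) ^ (1 / p)

lemma Good.add_le {n : ℕ} {p : ℝ} {F : (Fin n → ℝ) → ℝ} (hF : Good p F)
    {x y : Fin n → ℝ} (hx : 0 ≤ x) (hy : 0 ≤ y) {a b : ℝ} (ha : 0 < a) (hb : 0 < b)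
    (hxa : F x ≤ a ^ p) (hyb : F y ≤ b ^ p) : F (x + y) ≤ (a + b) ^ p := by
  have h1 : ∀ (z : Fin n → ℝ) (c : ℝ), 0 ≤ z → 0 < c → F z ≤ c ^ p → F (c⁻¹ • z) ≤ 1 := by
    intro z c hz hc h
    rw [hF.hom _ _ (inv_pos.2 hc) hz, Real.inv_rpow hc.le]
    have : 0 < c ^ p := Real.rpow_pos_of_pos hc p
    rw [inv_mul_le_iff₀ this]; simpa using h
  have hab : 0 < a + b := by positivity
  have e : x + y = (a + b) • ((a / (a + b)) • (a⁻¹ • x) + (b / (a + b)) • (b⁻¹ • y)) := by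
    ext i; simp only [Pi.add_apply, Pi.smul_apply, smul_eq_mul]; field_simp
  have nx : 0 ≤ a⁻¹ • x := smul_nonneg (by positivity) hx
  have ny : 0 ≤ b⁻¹ • y := smul_nonneg (by positivity) hy
  rw [e, hF.hom _ _ hab]
  · have h2 := hF.conv (a / (a + b)) (b / (a + b)) _ _ nx ny (by positivity) (by positivity)
      (by field_simp)
    have h3 := h1 x a hx ha hxa
    have h4 := h1 y b hy hb hyb
    have : F ((a / (a + b)) • (a⁻¹ • x) + (b / (a + b)) • (b⁻¹ • y)) ≤ 1 := by
      calc _ ≤ _ := h2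
        _ ≤ a / (a + b) * 1 + b / (a + b) * 1 := by gcongr
        _ = 1 := by field_simp
    have hp : 0 ≤ (a + b) ^ p := by positivity
    nlinarith
  · exact add_nonneg (smul_nonneg (by positivity) nx) (smul_nonneg (by positivity) ny)

lemma toNorm_pow {n : ℕ} {p : ℝ} (hp : 0 < p) {F : (Fin n → ℝ) → ℝ} (hF : Good p F)
    (x : Fin n → ℝ) : toNorm p F x ^ p = F |x| := by
  rw [toNorm, ← Real.rpow_mul (hF.nonneg _ (abs_nonneg x)), one_div, inv_mul_cancel₀ hp.ne',
    Real.rpow_one]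

lemma toNorm_nonneg {n : ℕ} {p : ℝ} {F : (Fin n → ℝ) → ℝ} (hF : Good p F)
    (x : Fin n → ℝ) : 0 ≤ toNorm p F x := Real.rpow_nonneg (hF.nonneg _ (abs_nonneg x)) _

lemma toNorm_le_iff {n : ℕ} {p : ℝ} (hp : 0 < p) {F : (Fin n → ℝ) → ℝ} (hF : Good p F)
    (x : Fin n → ℝ) {a : ℝ} (ha : 0 ≤ a) : toNorm p F x ≤ a ↔ F |x| ≤ a ^ p := by
  rw [← toNorm_pow hp hF, Real.rpow_le_rpow_iff (toNorm_nonneg hF x) ha hp]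

lemma toNorm_norm {n : ℕ} {p : ℝ} (hp : 0 < p) {F : (Fin n → ℝ) → ℝ} (hF : Good p F)
    (h0 : ∀ x, 0 ≤ x → F x = 0 → x = 0) : IsMonotoneNorm (toNorm p F) := by
  refine ⟨?_, ?_, ?_, ?_⟩
  · intro x y
    apply le_of_forall_pos_le_add
    intro ε hε
    have nx := toNorm_nonneg hF x
    have ny := toNorm_nonneg hF y
    have : toNorm p F (x + y) ≤ (toNorm p F x + ε / 2) + (toNorm p F y + ε / 2) := by
      rw [toNorm_le_iff hp hF _ (by positivity)]
      refine (hF.mono _ _ (abs_nonneg _) (abs_add_le x y)).trans ?_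
      refine hF.add_le (abs_nonneg _) (abs_nonneg _) (by positivity) (by positivity) ?_ ?_
      · rw [← toNorm_le_iff hp hF _ (by positivity)]; linarith
      · rw [← toNorm_le_iff hp hF _ (by positivity)]; linarith
    linarith
  · intro c x
    by_cases hc : c = 0
    · subst hc
      have h := hF.hom 2 0 (by norm_num) le_rfl
      have h2 : (1 : ℝ) < 2 ^ p := Real.one_lt_rpow (by norm_num) hp
      rw [smul_zero] at h
      have h3 : F 0 = 0 := by
        have : ((2 : ℝ) ^ p - 1) * F 0 = 0 := by linarith
        rcases mul_eq_zero.1 this with h | h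
        · linarith
        · exact h
      have : (1 / p) ≠ 0 := by positivity
      simp [toNorm, h3, hp.ne']
    · have hc' : 0 < |c| := abs_pos.2 hc
      have : |c • x| = |c| • |x| := by ext i; simp [abs_mul]
      rw [toNorm, this, hF.hom _ _ hc' (abs_nonneg x),
        Real.mul_rpow (by positivity) (hF.nonneg _ (abs_nonneg x)), ← Real.rpow_mul hc'.le,
        mul_one_div_cancel hp.ne', Real.rpow_one, toNorm]
  · intro x hx
    have h := toNorm_pow hp hF x
    rw [hx, Real.zero_rpow hp.ne'] at h
    have h1 := h0 _ (abs_nonneg x) h.symm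
    ext i
    have h2 := congrFun h1 i
    simpa using h2
  · intro x y hx hxy
    rw [toNorm, toNorm, abs_of_nonneg hx, abs_of_nonneg (hx.trans hxy)]
    exact Real.rpow_le_rpow (hF.nonneg _ hx) (hF.mono _ _ hx hxy) (by positivity)

lemma toNorm_smod {n : ℕ} {p : ℝ} (hp : 0 < p) {F : (Fin n → ℝ) → ℝ} (hF : Good p F) :
    IsPSupermodular (toNorm p F) p := by
  intro u v w hu hv hw
  simp only [toNorm_pow hp hF]
  rw [abs_of_nonneg (add_nonneg hu hw), abs_of_nonneg hu, abs_of_nonneg (add_nonneg hu hv),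
    abs_of_nonneg (add_nonneg (add_nonneg hu hv) hw)]
  have := hF.smod u v w hu hv hw
  linarith

/-- the penalised linear functional -/
def val {n : ℕ} (p k : ℝ) (x r : Fin n → ℝ) (s : ℝ) : ℝ :=
  ∑ i, (r i ^ (p - 1) * x i - r i ^ p) - k * s ^ p

def vals {n : ℕ} (p k : ℝ) (x : Fin n → ℝ) : Set ℝ :=
  {t | ∃ (r : Fin n → ℝ) (s : ℝ), 0 ≤ r ∧ 0 ≤ s ∧ (∀ i, r i ≤ s) ∧ t = val p k x r s}

def Fk {n : ℕ} (p k : ℝ) (x : Fin n → ℝ) : ℝ := sSup (vals p k x)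

lemma pow_split {p r : ℝ} (hp : 1 < p) (hr : 0 ≤ r) : r ^ p = r ^ (p - 1) * r := by
  conv_lhs => rw [show p = (p - 1) + 1 by ring]
  rw [Real.rpow_add_one' hr (by linarith)]

lemma term_le {p r x : ℝ} (hp : 1 < p) (hr : 0 ≤ r) (hx : 0 ≤ x) :
    r ^ (p - 1) * x - r ^ p ≤ x ^ p := by
  have hrp : 0 ≤ r ^ (p - 1) := by positivity
  have hxp : 0 ≤ x ^ p := by positivity
  rw [pow_split hp hr]
  rcases le_total r x with h | h
  · rw [pow_split hp hx]
    have : r ^ (p - 1) ≤ x ^ (p - 1) := Real.rpow_le_rpow hr h (by linarith)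
    nlinarith
  · nlinarith

lemma vals_nonempty {n : ℕ} {p k : ℝ} (hp : 1 < p) (x : Fin n → ℝ) : 0 ∈ vals p k x := by
  refine ⟨0, 0, le_rfl, le_rfl, fun i => le_rfl, ?_⟩
  have h1 : p ≠ 0 := by linarith
  have h2 : p - 1 ≠ 0 := by linarith
  simp [val, Real.zero_rpow h1, Real.zero_rpow h2]

lemma vals_bdd {n : ℕ} {p k : ℝ} (hp : 1 < p) (hk : 0 ≤ k) {x : Fin n → ℝ} (hx : 0 ≤ x) :
    BddAbove (vals p k x) := by
  refine ⟨∑ i, x i ^ p, ?_⟩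
  rintro t ⟨r, s, hr, hs, -, rfl⟩
  have : ∑ i, (r i ^ (p - 1) * x i - r i ^ p) ≤ ∑ i, x i ^ p :=
    Finset.sum_le_sum fun i _ => term_le hp (hr i) (hx i)
  have : 0 ≤ k * s ^ p := by positivity
  rw [val]; linarith

lemma le_Fk {n : ℕ} {p k : ℝ} (hp : 1 < p) (hk : 0 ≤ k) {x : Fin n → ℝ} (hx : 0 ≤ x)
    {r : Fin n → ℝ} {s : ℝ} (hr : 0 ≤ r) (hs : 0 ≤ s) (h : ∀ i, r i ≤ s) :
    val p k x r s ≤ Fk p k x :=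
  le_csSup (vals_bdd hp hk hx) ⟨r, s, hr, hs, h, rfl⟩

lemma Fk_le {n : ℕ} {p k : ℝ} (hp : 1 < p) {x : Fin n → ℝ} {B : ℝ}
    (h : ∀ (r : Fin n → ℝ) (s : ℝ), 0 ≤ r → 0 ≤ s → (∀ i, r i ≤ s) → val p k x r s ≤ B) :
    Fk p k x ≤ B := by
  refine csSup_le ⟨0, vals_nonempty hp x⟩ ?_
  rintro t ⟨r, s, hr, hs, h', rfl⟩
  exact h r s hr hs h'

lemma Fk_hom_le {n : ℕ} {p k : ℝ} (hp : 1 < p) (hk : 0 ≤ k) {c : ℝ} {x : Fin n → ℝ}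
    (hc : 0 < c) (hx : 0 ≤ x) : Fk p k (c • x) ≤ c ^ p * Fk p k x := by
  refine Fk_le hp fun r s hr hs h => ?_
  have hci : 0 ≤ c⁻¹ := by positivity
  have h1 := le_Fk (p := p) hp hk hx (r := c⁻¹ • r) (s := c⁻¹ * s) (smul_nonneg hci hr)
    (by positivity) (fun i => mul_le_mul_of_nonneg_left (h i) hci)
  have hcp : 0 < c ^ p := by positivity
  have h2 : val p k (c • x) r s = c ^ p * val p k x (c⁻¹ • r) (c⁻¹ * s) := by
    simp only [val, mul_sub, Finset.mul_sum]
    have key : ∀ t : ℝ, 0 ≤ t → c ^ p * (c⁻¹ * t) ^ p = t ^ p := by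
      intro t ht
      rw [← Real.mul_rpow hc.le (by positivity)]
      congr 1; field_simp
    have key2 : ∀ t : ℝ, 0 ≤ t → c ^ p * (c⁻¹ * t) ^ (p - 1) = t ^ (p - 1) * c := by
      intro t ht
      rw [pow_split hp hc.le, mul_right_comm, ← Real.mul_rpow hc.le (by positivity)]
      congr 2; field_simp
    congr 1
    · refine Finset.sum_congr rfl fun i _ => ?_
      simp only [Pi.smul_apply, smul_eq_mul]
      rw [key _ (hr i), ← mul_assoc (c ^ p), key2 _ (hr i)]; ring
    · rw [mul_left_comm, key s hs]
  rw [h2]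
  exact mul_le_mul_of_nonneg_left h1 hcp.le

lemma Fk_smod {n : ℕ} {p k : ℝ} (hp : 1 < p) (hk : 0 ≤ k) (u v w : Fin n → ℝ)
    (hu : 0 ≤ u) (hv : 0 ≤ v) (hw : 0 ≤ w) :
    Fk p k (u + w) + Fk p k (u + v) ≤ Fk p k (u + v + w) + Fk p k u := by
  rw [← le_sub_iff_add_le]
  refine Fk_le hp fun r s hr hs h => ?_
  rw [le_sub_comm]
  refine Fk_le hp fun r' s' hr' hs' h' => ?_
  rw [le_sub_iff_add_le]
  have h1 := le_Fk (p := p) hp hk (add_nonneg (add_nonneg hu hv) hw)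
    (r := fun i => max (r i) (r' i)) (s := max s s') (fun i => le_max_of_le_left (hr i))
    (le_max_of_le_left hs) (fun i => max_le_max (h i) (h' i))
  have h2 := le_Fk (p := p) hp hk hu
    (r := fun i => min (r i) (r' i)) (s := min s s') (fun i => le_min (hr i) (hr' i))
    (le_min hs hs') (fun i => min_le_min (h i) (h' i))
  refine le_trans ?_ (add_le_add h1 h2)
  have hmod : ∀ (a b e : ℝ), max a b ^ e + min a b ^ e = a ^ e + b ^ e := by
    intro a b e
    rcases le_total a b with h | h <;> simp [h, add_comm]
  simp only [val]
  have hs3 := hmod s s' p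
  have : ∑ i, (r' i ^ (p - 1) * (u + v) i - r' i ^ p) + ∑ i, (r i ^ (p - 1) * (u + w) i - r i ^ p)
      ≤ ∑ i, (max (r i) (r' i) ^ (p - 1) * (u + v + w) i - max (r i) (r' i) ^ p)
        + ∑ i, (min (r i) (r' i) ^ (p - 1) * u i - min (r i) (r' i) ^ p) := by
    rw [← Finset.sum_add_distrib, ← Finset.sum_add_distrib]
    refine Finset.sum_le_sum fun i _ => ?_
    have e1 := hmod (r i) (r' i) p
    have e2 := hmod (r i) (r' i) (p - 1)
    have m1 : r i ^ (p - 1) ≤ max (r i) (r' i) ^ (p - 1) :=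
      Real.rpow_le_rpow (hr i) (le_max_left _ _) (by linarith)
    have m2 : r' i ^ (p - 1) ≤ max (r i) (r' i) ^ (p - 1) :=
      Real.rpow_le_rpow (hr' i) (le_max_right _ _) (by linarith)
    have w1 := mul_le_mul_of_nonneg_right m1 (hw i)
    have w2 := mul_le_mul_of_nonneg_right m2 (hv i)
    have e3 := congrArg (· * u i) e2
    simp only [Pi.add_apply, add_mul] at *
    linarith
  have e4 := congrArg (k * ·) hs3
  simp only [mul_add] at e4
  linarith

lemma Fk_good {n : ℕ} {p k : ℝ} (hp : 1 < p) (hk : 0 ≤ k) :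
    Good p (Fk p k : (Fin n → ℝ) → ℝ) where
  nonneg x hx := le_csSup (vals_bdd hp hk hx) (vals_nonempty hp x)
  mono x y hx hy := by
    refine Fk_le hp fun r s hr hs h => ?_
    refine le_trans ?_ (le_Fk hp hk (hx.trans hy) hr hs h)
    unfold val
    gcongr with i
    · exact Real.rpow_nonneg (hr i) _
    · exact hy i
  hom c x hc hx := by
    apply le_antisymm (Fk_hom_le hp hk hc hx)
    have h := Fk_hom_le (p := p) hp hk (inv_pos.2 hc) (smul_nonneg hc.le hx)
    rw [inv_smul_smul₀ hc.ne', Real.inv_rpow hc.le] at h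
    rwa [← le_inv_mul_iff₀ (by positivity)]
  conv a b x y hx hy ha hb hab := by
    refine Fk_le hp fun r s hr hs h => ?_
    have h1 := mul_le_mul_of_nonneg_left (le_Fk (p := p) hp hk hx hr hs h) ha
    have h2 := mul_le_mul_of_nonneg_left (le_Fk (p := p) hp hk hy hr hs h) hb
    refine le_trans (le_of_eq ?_) (add_le_add h1 h2)
    have hb' : b = 1 - a := by linarith
    subst hb'
    simp only [val, mul_sub, Finset.mul_sum, Finset.sum_sub_distrib, Pi.add_apply, Pi.smul_apply,
      smul_eq_mul, mul_add, Finset.sum_add_distrib]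
    simp only [← Finset.mul_sum, mul_left_comm _ a, mul_left_comm _ (1 - a)]
    ring
  smod := Fk_smod hp hk

lemma Fk_lower {n : ℕ} {p : ℝ} {k : ℕ} (hp : 1 < p) (hk : 1 ≤ k) {x : Fin n → ℝ} (hx : 0 ≤ x)
    (S : Finset (Fin n)) (hS : k ≤ S.card) {t : ℝ} (ht : 0 ≤ t) (h : ∀ i ∈ S, t ≤ x i) :
    (t / 3) ^ p ≤ Fk p k x := by
  have hs : 0 ≤ t / 3 := by positivity
  refine le_trans ?_ (le_Fk hp (Nat.cast_nonneg k) hx (r := fun i => if i ∈ S then t / 3 else 0)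
    (s := t / 3) (fun i => ?_) hs (fun i => ?_))
  · have h1 : p ≠ 0 := by linarith
    have h2 : p - 1 ≠ 0 := by linarith
    have hpp : 0 ≤ (t / 3) ^ (p - 1) := by positivity
    have hpp' : 0 ≤ (t / 3) ^ p := by positivity
    have : ∑ i ∈ S, 2 * (t / 3) ^ p ≤ ∑ i, ((if i ∈ S then t / 3 else 0) ^ (p - 1) * x i
        - (if i ∈ S then t / 3 else 0) ^ p) := by
      rw [← Finset.sum_subset (Finset.subset_univ S)]
      · refine Finset.sum_le_sum fun i hi => ?_
        rw [if_pos hi, pow_split hp hs]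
        nlinarith [h i hi]
      · intro i _ hi
        simp [hi, Real.zero_rpow h1, Real.zero_rpow h2]
    rw [Finset.sum_const, nsmul_eq_mul] at this
    have hc : (k : ℝ) ≤ S.card := by exact_mod_cast hS
    have hc1 : (1 : ℝ) ≤ k := by exact_mod_cast hk
    rw [val]
    nlinarith
  · simp only [Pi.zero_apply]; split_ifs <;> simp [hs]
  · split_ifs <;> simp [hs]

lemma Fk_upper {n : ℕ} {p : ℝ} {k : ℕ} (hp : 1 < p) (hkn : k ≤ n) {x : Fin n → ℝ} (hx : 0 ≤ x)
    (S : Finset (Fin n)) {T : ℝ} (hT : 0 ≤ T) (hS : ∑ i ∈ S, x i ≤ k * T)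
    (h : ∀ i ∉ S, x i ≤ T) : Fk p k x ≤ 2 * n * T ^ p := by
  refine Fk_le hp fun r s hr hs hrs => ?_
  have hsp : 0 ≤ s ^ (p - 1) := by positivity
  have hTp : 0 ≤ T ^ p := by positivity
  have h1 : ∑ i ∈ S, (r i ^ (p - 1) * x i - r i ^ p) ≤ s ^ (p - 1) * (k * T) := by
    refine le_trans ?_ (mul_le_mul_of_nonneg_left hS hsp)
    rw [Finset.mul_sum]
    refine Finset.sum_le_sum fun i _ => ?_
    have a1 : r i ^ (p - 1) ≤ s ^ (p - 1) := Real.rpow_le_rpow (hr i) (hrs i) (by linarith)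
    have a2 : 0 ≤ r i ^ p := Real.rpow_nonneg (hr i) _
    have a3 := mul_le_mul_of_nonneg_right a1 (hx i)
    linarith
  have h2 : ∑ i ∈ Sᶜ, (r i ^ (p - 1) * x i - r i ^ p) ≤ n * T ^ p := by
    calc _ ≤ ∑ i ∈ Sᶜ, T ^ p := by
          refine Finset.sum_le_sum fun i hi => ?_
          refine (term_le hp (hr i) (hx i)).trans ?_
          exact Real.rpow_le_rpow (hx i) (h i (by simpa using hi)) (by linarith)
      _ = (Sᶜ.card : ℝ) * T ^ p := by simp
      _ ≤ n * T ^ p := by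
          gcongr
          simpa using Finset.card_le_univ Sᶜ
  have h3 := Finset.sum_add_sum_compl S (fun i => r i ^ (p - 1) * x i - r i ^ p)
  have h4 := term_le hp hs hT
  have h5 : (k : ℝ) * (s ^ (p - 1) * T - s ^ p) ≤ n * T ^ p :=
    (mul_le_mul_of_nonneg_left h4 (Nat.cast_nonneg k)).trans (by gcongr)
  rw [val, ← h3]
  linarith

/-- indicator vector -/
def ind {n : ℕ} (S : Finset (Fin n)) : Fin n → ℝ := fun i => if i ∈ S then 1 else 0

lemma ind_nonneg {n : ℕ} (S : Finset (Fin n)) : 0 ≤ ind S := by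
  intro i; simp only [ind, Pi.zero_apply]; split_ifs <;> norm_num

lemma ind_mono {n : ℕ} {S T : Finset (Fin n)} (h : S ⊆ T) : ind S ≤ ind T := by
  intro i; simp only [ind]; split_ifs with h1 h2 <;> first | exact absurd (h h1) ‹_› | norm_num

lemma ind_card_eq {n : ℕ} {N : (Fin n → ℝ) → ℝ} (hs : IsSymmetricNorm N)
    {S T : Finset (Fin n)} (h : S.card = T.card) : N (ind S) = N (ind T) := by
  let e : {x // x ∈ S} ≃ {x // x ∈ T} := Finset.equivOfCardEq h
  rw [← hs e.extendSubtype (ind T)]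
  congr 1
  ext i
  simp only [ind, Function.comp]
  by_cases hi : i ∈ S
  · rw [if_pos hi, if_pos (e.extendSubtype_mem i hi)]
  · rw [if_neg hi, if_neg (e.extendSubtype_not_mem i hi)]

def f {n : ℕ} (N : (Fin n → ℝ) → ℝ) (k : ℕ) : ℝ :=
  N (ind (Finset.univ.filter fun i : Fin n => i.val < k))

lemma f_eq {n : ℕ} {N : (Fin n → ℝ) → ℝ} (hs : IsSymmetricNorm N)
    {S : Finset (Fin n)} {k : ℕ} (h : S.card = k) (hk : k ≤ n) : N (ind S) = f N k := by
  apply ind_card_eq hs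
  rw [h, Fin.card_filter_val_lt, min_eq_right hk]

lemma f_le {n : ℕ} {N : (Fin n → ℝ) → ℝ} (hN : IsMonotoneNorm N) (hs : IsSymmetricNorm N)
    {S : Finset (Fin n)} {k : ℕ} (h : S.card ≤ k) (hk : k ≤ n) : N (ind S) ≤ f N k := by
  obtain ⟨T, hST, hT⟩ := Finset.exists_superset_card_eq h (by simpa using hk)
  rw [← f_eq hs hT hk]
  exact hN.2.2.2 _ _ (ind_nonneg S) (ind_mono hST)

lemma f_le2 {n : ℕ} {N : (Fin n → ℝ) → ℝ} (hN : IsMonotoneNorm N) (hs : IsSymmetricNorm N)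
    {S : Finset (Fin n)} {k : ℕ} (h : S.card ≤ 2 * k) (hk : k ≤ n) :
    N (ind S) ≤ 2 * f N k := by
  obtain ⟨A, hA, hAc⟩ := Finset.exists_subset_card_eq (min_le_left S.card k)
  have e : ind S = ind A + ind (S \ A) := by
    ext i
    simp only [ind, Pi.add_apply, Finset.mem_sdiff]
    by_cases h1 : i ∈ A
    · simp [h1, hA h1]
    · simp [h1]
  have c1 : A.card ≤ k := by omega
  have c2 : (S \ A).card ≤ k := by
    rw [Finset.card_sdiff_of_subset hA]; omega
  have := hN.1 (ind A) (ind (S \ A))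
  rw [e]
  linarith [f_le hN hs c1 hk, f_le hN hs c2 hk]

lemma N_sum {n : ℕ} {N : (Fin n → ℝ) → ℝ} (hN : IsMonotoneNorm N) {ι : Type*}
    (s : Finset ι) (g : ι → Fin n → ℝ) : N (∑ j ∈ s, g j) ≤ ∑ j ∈ s, N (g j) := by
  have h0 : N 0 = 0 := by simpa using hN.2.1 0 0
  exact Finset.le_sum_of_subadditive N h0.le hN.1 s g

lemma N_nonneg {n : ℕ} {N : (Fin n → ℝ) → ℝ} (hN : IsMonotoneNorm N) {x : Fin n → ℝ}
    (hx : 0 ≤ x) : 0 ≤ N x := by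
  have h0 : N 0 = 0 := by simpa using hN.2.1 0 0
  rw [← h0]; exact hN.2.2.2 _ _ le_rfl hx

/-- averaging over rotations of `S` -/
lemma avg {n : ℕ} {N : (Fin n → ℝ) → ℝ} (hN : IsMonotoneNorm N) (hs : IsSymmetricNorm N)
    {x : Fin n → ℝ} (hx : 0 ≤ x) (S : Finset (Fin n)) :
    (∑ i ∈ S, x i) * N (ind S) ≤ S.card * N x := by
  classical
  let y : Fin n → ℝ := fun i => if i ∈ S then x i else 0
  have hy : 0 ≤ y := by
    intro i; simp only [y, Pi.zero_apply]; split_ifs; exacts [hx i, le_rfl]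
  have hyx : y ≤ x := by
    intro i; simp only [y]; split_ifs; exacts [le_rfl, hx i]
  rcases Nat.eq_zero_or_pos S.card with h0 | hpos
  · rw [Finset.card_eq_zero] at h0; subst h0; simp
  have : NeZero S.card := ⟨hpos.ne'⟩
  let e : {i // i ∈ S} ≃ Fin S.card := S.equivFin
  let ρ : Fin S.card → Equiv.Perm (Fin n) := fun r =>
    Equiv.Perm.ofSubtype (e.trans ((Equiv.addLeft r).trans e.symm))
  have hsum : ∑ r, y ∘ ρ r = (∑ i ∈ S, x i) • ind S := by
    ext i
    simp only [Finset.sum_apply, Function.comp, Pi.smul_apply, smul_eq_mul, ind]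
    by_cases hi : i ∈ S
    · rw [if_pos hi, mul_one]
      have h1 : ∀ r, y (ρ r i) = x (e.symm (r + e ⟨i, hi⟩)) := by
        intro r
        have : ρ r i = e.symm (r + e ⟨i, hi⟩) := by
          simp only [ρ]
          rw [Equiv.Perm.ofSubtype_apply_of_mem _ hi]
          simp
        rw [this]
        simp [y]
      simp only [h1]
      refine (Equiv.sum_comp (Equiv.addRight (e ⟨i, hi⟩)) (fun r => x (e.symm r))).trans ?_
      refine (Equiv.sum_comp e.symm (fun j => x j)).trans ?_
      exact Finset.sum_coe_sort S x
    · rw [if_neg hi, mul_zero]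
      refine Finset.sum_eq_zero fun r _ => ?_
      have : ρ r i = i := Equiv.Perm.ofSubtype_apply_of_not_mem _ hi
      rw [this]; simp [y, hi]
  have h1 := N_sum hN Finset.univ (fun r => y ∘ ρ r)
  rw [hsum, hN.2.1, abs_of_nonneg (Finset.sum_nonneg fun i _ => hx i)] at h1
  have h2 : ∀ r, N (y ∘ ρ r) = N y := fun r => hs (ρ r) y
  rw [Finset.sum_congr rfl (fun r _ => h2 r)] at h1
  simp only [Finset.sum_const, Finset.card_univ, Fintype.card_fin, nsmul_eq_mul] at h1
  exact h1.trans (mul_le_mul_of_nonneg_left (hN.2.2.2 _ _ hy hyx) (Nat.cast_nonneg _))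

lemma f_pos {n : ℕ} {N : (Fin n → ℝ) → ℝ} (hN : IsMonotoneNorm N) (hn : 2 ≤ n) {k : ℕ}
    (hk : 1 ≤ k) : 0 < f N k := by
  refine lt_of_le_of_ne (N_nonneg hN (ind_nonneg _)) fun h => ?_
  have h1 := congrFun (hN.2.2.1 _ h.symm) ⟨0, by omega⟩
  have h2 : 0 < k := hk
  simp [ind, h2] at h1

lemma upper_N {n : ℕ} {N : (Fin n → ℝ) → ℝ} (hN : IsMonotoneNorm N) (hs : IsSymmetricNorm N)
    (hn : 2 ≤ n) {p : ℝ} (hp : 1 < p) {k : ℕ} (hk : 1 ≤ k) (hkn : k ≤ n) {x : Fin n → ℝ}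
    (hx : 0 ≤ x) : Fk p k x ≤ 2 * n * (N x / f N k) ^ p := by
  have hf := f_pos hN hn hk
  have hNx := N_nonneg hN hx
  set T := N x / f N k with hT
  have hT0 : 0 ≤ T := by positivity
  have hTf : N x = T * f N k := by rw [hT]; field_simp
  set B : Finset (Fin n) := Finset.univ.filter fun i => T < x i with hB
  have hBc : B.card ≤ k := by
    by_contra hcon
    push Not at hcon
    obtain ⟨B', hB', hc⟩ := Finset.exists_subset_card_eq hcon.le
    have hne : B'.Nonempty := by rw [← Finset.card_pos]; omega
    obtain ⟨i0, hi0, hmin⟩ := Finset.exists_min_image B' x hne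
    have hlt : T < x i0 := by simpa [hB] using hB' hi0
    have h1 : x i0 • ind B' ≤ x := by
      intro i
      simp only [ind, Pi.smul_apply, smul_eq_mul]
      split_ifs with h
      · simpa using hmin i h
      · simpa using hx i
    have h2 := hN.2.2.2 _ _ (smul_nonneg (hx i0) (ind_nonneg B')) h1
    rw [hN.2.1, abs_of_nonneg (hx i0), f_eq hs hc hkn, hTf] at h2
    have := (mul_le_mul_iff_left₀ hf).1 h2
    linarith
  obtain ⟨S, hBS, hSc⟩ := Finset.exists_superset_card_eq hBc (by simpa using hkn)
  refine Fk_upper hp hkn hx S hT0 ?_ ?_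
  · have := avg hN hs hx S
    rw [f_eq hs hSc hkn, hSc, hTf, ← mul_assoc] at this
    exact (mul_le_mul_iff_left₀ hf).1 this
  · intro i hi
    by_contra hcon
    push Not at hcon
    exact hi (hBS (by simpa [hB] using hcon))

/-- the main dyadic decomposition -/
lemma dyadic {n : ℕ} {N : (Fin n → ℝ) → ℝ} (hN : IsMonotoneNorm N) (hs : IsSymmetricNorm N)
    {x : Fin n → ℝ} (hx : 0 ≤ x) (L : ℕ) (hL : 2 ^ L ≤ n) (hL' : n ≤ 2 ^ (L + 1))
    (a : ℕ → ℝ) (ha : ∀ j, 0 ≤ a j)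
    (hA : ∀ j ≤ L, (Finset.univ.filter fun i : Fin n => a j < x i).card < 2 ^ j) :
    N x ≤ ∑ j ∈ Finset.range (L + 1), a j * (2 * f N (2 ^ j)) := by
  classical
  let A : ℕ → Finset (Fin n) := fun j =>
    if j ≤ L then Finset.univ.filter fun i : Fin n => a j < x i else Finset.univ
  have hAc : ∀ j ≤ L, (A (j + 1)).card ≤ 2 * 2 ^ j := by
    intro j hj
    rw [← pow_succ']
    by_cases h : j + 1 ≤ L
    · simp only [A, if_pos h]; exact (hA _ h).le
    · have : j = L := by omega
      subst this
      simp only [A, if_neg h]; simpa using hL'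
  have hle : x ≤ ∑ j ∈ Finset.range (L + 1), a j • ind (A (j + 1)) := by
    intro i
    have hex : ∃ j, i ∈ A j := ⟨L + 1, by simp [A]⟩
    have h1 := Nat.find_spec hex
    have h2 : Nat.find hex ≤ L + 1 := Nat.find_min' hex (by simp [A])
    have h3 : Nat.find hex ≠ 0 := by
      intro h0
      rw [h0] at h1
      have := hA 0 (Nat.zero_le _)
      simp only [A, Nat.zero_le, if_true] at h1
      have hc := Finset.card_pos.2 ⟨i, h1⟩
      omega
    obtain ⟨j, hj⟩ := Nat.exists_eq_succ_of_ne_zero h3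
    have hjL : j ≤ L := by omega
    have h4 : i ∉ A j := Nat.find_min hex (by omega)
    have h5 : x i ≤ a j := by simpa [A, hjL] using h4
    rw [hj] at h1
    rw [Finset.sum_apply]
    have h6 : a j * ind (A (j + 1)) i ≤
        ∑ j ∈ Finset.range (L + 1), (a j • ind (A (j + 1))) i :=
      Finset.single_le_sum (f := fun j => (a j • ind (A (j + 1))) i)
        (fun j _ => mul_nonneg (ha j) (ind_nonneg _ i)) (Finset.mem_range.2 (by omega))
    have h7 : ind (A (j + 1)) i = 1 := if_pos h1
    rw [h7, mul_one] at h6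
    exact h5.trans h6
  refine (hN.2.2.2 _ _ hx hle).trans ((N_sum hN _ _).trans ?_)
  refine Finset.sum_le_sum fun j hj => ?_
  have hjL : j ≤ L := by have := Finset.mem_range.1 hj; omega
  rw [hN.2.1, abs_of_nonneg (ha j)]
  exact mul_le_mul_of_nonneg_left (f_le2 hN hs (hAc j hjL)
    ((Nat.pow_le_pow_right (by norm_num) hjL).trans hL)) (ha j)

lemma main {n : ℕ} (hn : 2 ≤ n) {N : (Fin n → ℝ) → ℝ} (hN : IsMonotoneNorm N)
    (hs : IsSymmetricNorm N) : ∃ M : (Fin n → ℝ) → ℝ, IsMonotoneNorm M ∧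
          IsPSupermodular M (24 * Real.logb 2 n) ∧
          ∀ x : Fin n → ℝ, 0 ≤ x → N x ≤ M x ∧ M x ≤ 24 * Real.logb 2 n * N x := by
  have hnR : (2 : ℝ) ≤ n := by exact_mod_cast hn
  have hn0 : (0 : ℝ) < n := by linarith
  set l := Real.logb 2 n with hl
  have h2l : (2 : ℝ) ^ l = n := Real.rpow_logb (by norm_num) (by norm_num) hn0
  have hl1 : 1 ≤ l := by
    rw [hl, Real.le_logb_iff_rpow_le (by norm_num) hn0]; simpa using hnR
  set p := 24 * l with hpdef
  have hp : 1 < p := by linarith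
  have hp0 : 0 < p := by linarith
  set L := Nat.log 2 n with hLdef
  have hL : 2 ^ L ≤ n := Nat.pow_log_le_self 2 (by omega)
  have hL' : n < 2 ^ (L + 1) := Nat.lt_pow_succ_log_self (by norm_num) n
  have hLl : (L : ℝ) ≤ l := by
    rw [hl, Real.le_logb_iff_rpow_le (by norm_num) hn0, Real.rpow_natCast]
    exact_mod_cast hL
  have hLn : ((L : ℝ) + 1) ≤ n := by
    have : L < 2 ^ L := Nat.lt_two_pow_self
    exact_mod_cast (by omega : L + 1 ≤ n)
  have hbig : ((L : ℝ) + 1) * (2 * n) ≤ 2 ^ p := by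
    have h1 : (n : ℝ) ^ (3 : ℕ) ≤ 2 ^ p := by
      rw [← h2l, ← Real.rpow_natCast, ← Real.rpow_mul (by norm_num)]
      apply Real.rpow_le_rpow_of_exponent_le (by norm_num)
      push_cast; linarith
    refine le_trans ?_ h1
    calc ((L : ℝ) + 1) * (2 * n) ≤ n * (n * n) := by gcongr
      _ = _ := by ring
  set K : ℝ := 6 * ((L : ℝ) + 1) with hK
  have hK0 : 0 < K := by positivity
  have hfp : ∀ j, 0 < f N (2 ^ j) := fun j => f_pos hN hn Nat.one_le_two_pow
  have hkn : ∀ j ≤ L, 2 ^ j ≤ n := fun j hj =>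
    (Nat.pow_le_pow_right (by norm_num) hj).trans hL
  set F : (Fin n → ℝ) → ℝ := fun x =>
    ∑ j ∈ Finset.range (L + 1), (K * f N (2 ^ j)) ^ p * Fk p ((2 ^ j : ℕ) : ℝ) x with hF
  have hG : Good p F := Good.sum _ _ _
    (fun j => Real.rpow_nonneg (mul_nonneg hK0.le (hfp j).le) _)
    (fun j _ => Fk_good hp (Nat.cast_nonneg _))
  have lower : ∀ x, 0 ≤ x → N x ≤ toNorm p F x := by
    intro x hx
    set m := toNorm p F x with hm
    have hm0 : 0 ≤ m := toNorm_nonneg hG x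
    have hmp : m ^ p = F x := by rw [hm, toNorm_pow hp0 hG, abs_of_nonneg hx]
    have h1 := dyadic hN hs hx L hL hL'.le (fun j => 3 * m / (K * f N (2 ^ j)))
      (fun j => by have := hfp j; positivity) ?_
    · refine h1.trans (le_of_eq ?_)
      have : ∀ j ∈ Finset.range (L + 1),
          3 * m / (K * f N (2 ^ j)) * (2 * f N (2 ^ j)) = 6 * m / K := by
        intro j _
        have := hfp j
        field_simp; ring
      rw [Finset.sum_congr rfl this]
      simp only [Finset.sum_const, Finset.card_range, nsmul_eq_mul, hK]
      push_cast
      field_simp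
    · intro j hj
      by_contra hcon
      push Not at hcon
      set B : Finset (Fin n) :=
        Finset.univ.filter fun i : Fin n => 3 * m / (K * f N (2 ^ j)) < x i with hB
      have hne : B.Nonempty := by
        rw [← Finset.card_pos]; exact lt_of_lt_of_le (by positivity) hcon
      obtain ⟨i0, hi0, hmin⟩ := Finset.exists_min_image B x hne
      have hlt : 3 * m / (K * f N (2 ^ j)) < x i0 := by simpa [hB] using hi0
      have h2 := Fk_lower (p := p) hp Nat.one_le_two_pow hx B hcon (hx i0) hmin
      have hKf : 0 < K * f N (2 ^ j) := mul_pos hK0 (hfp j)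
      have h3 : (K * f N (2 ^ j)) ^ p * Fk p ((2 ^ j : ℕ) : ℝ) x ≤ F x :=
        Finset.single_le_sum
          (f := fun j => (K * f N (2 ^ j)) ^ p * Fk p ((2 ^ j : ℕ) : ℝ) x)
          (fun j _ => mul_nonneg (Real.rpow_nonneg (mul_nonneg hK0.le (hfp j).le) _)
            ((Fk_good hp (Nat.cast_nonneg _)).nonneg x hx)) (Finset.mem_range.2 (by omega))
      have hx0 : 0 ≤ x i0 := hx i0
      have h4 : (K * f N (2 ^ j) * (x i0 / 3)) ^ p ≤ m ^ p := by
        rw [hmp, Real.mul_rpow hKf.le (by positivity)]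
        exact (mul_le_mul_of_nonneg_left h2 (by positivity)).trans h3
      rw [Real.rpow_le_rpow_iff (by positivity) hm0 hp0] at h4
      rw [div_lt_iff₀ hKf] at hlt
      linarith
  refine ⟨toNorm p F, toNorm_norm hp0 hG ?_, toNorm_smod hp0 hG, fun x hx => ⟨lower x hx, ?_⟩⟩
  · intro x hx h
    have h1 := lower x hx
    rw [toNorm, abs_of_nonneg hx, h, Real.zero_rpow (by positivity)] at h1
    exact hN.2.2.1 x (le_antisymm h1 (N_nonneg hN hx))
  · have hNx := N_nonneg hN hx
    have h1 : toNorm p F x ≤ 2 * (K * N x) := by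
      rw [toNorm_le_iff hp0 hG _ (by positivity), abs_of_nonneg hx]
      have h2 : ∀ j ∈ Finset.range (L + 1), (K * f N (2 ^ j)) ^ p * Fk p ((2 ^ j : ℕ) : ℝ) x
          ≤ 2 * n * (K * N x) ^ p := by
        intro j hj
        have hjL : j ≤ L := by have := Finset.mem_range.1 hj; omega
        have hKf : 0 < K * f N (2 ^ j) := mul_pos hK0 (hfp j)
        have hfj := hfp j
        have h3 := upper_N hN hs hn hp Nat.one_le_two_pow (hkn j hjL) hx
        refine (mul_le_mul_of_nonneg_left h3 (by positivity)).trans (le_of_eq ?_)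
        rw [mul_left_comm, ← Real.mul_rpow hKf.le (by positivity)]
        congr 2
        field_simp
      refine (Finset.sum_le_sum h2).trans ?_
      simp only [Finset.sum_const, Finset.card_range, nsmul_eq_mul]
      rw [Real.mul_rpow (by norm_num) (mul_nonneg hK0.le hNx), ← mul_assoc]
      push_cast
      exact mul_le_mul_of_nonneg_right hbig (Real.rpow_nonneg (mul_nonneg hK0.le hNx) _)
    refine h1.trans ?_
    rw [← mul_assoc]
    gcongr
    rw [hK]; linarith

end SupApprox

/-- Every monotone symmetric norm on ℝⁿ (n ≥ 2) can be `O(log n)`-approximated by an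
`O(log n)`-supermodular monotone norm. -/
theorem symmetricNorm_supermodular_approx :
    ∃ C : ℝ, 1 ≤ C ∧ ∀ n : ℕ, 2 ≤ n →
      ∀ N : (Fin n → ℝ) → ℝ, IsMonotoneNorm N → IsSymmetricNorm N →
        ∃ M : (Fin n → ℝ) → ℝ, IsMonotoneNorm M ∧
          IsPSupermodular M (C * Real.logb 2 n) ∧
          ∀ x : Fin n → ℝ, 0 ≤ x → N x ≤ M x ∧ M x ≤ C * Real.logb 2 n * N x := by
  refine ⟨24, by norm_num, fun n hn N hN hs => SupApprox.main hn hN hs⟩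
end
end

section
/- Let m ≥ 1 and identify ℝ^{m·m} with m×m matrices. Define the monotone norm N(x) = ∑_{k=1}^m max_{1≤i≤m} |x_{i,k}| (the sum over the m columns of the largest entry in absolute value of each column). Suppose p ≥ 1, α ≥ 1, and f : ℝ^{m·m}₊ → ℝ₊ is monotone (f(x) ≤ f(y) whenever 0 ≤ x ≤ y), subadditive (f(x+y) ≤ f(x)+f(y) for x, y ≥ 0), f^p is supermodular (f(u+v+w)^p − f(u+v)^p ≥ f(u+w)^p − f(u)^p for all u, v, w ≥ 0), and N(x) ≤ f(x) ≤ α·N(x) for all x ≥ 0. Then α·p ≥ (ln 2)·m. -/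
noncomputable section

lemma aux_marg_up {V ι : Type*} [AddCommGroup V] [PartialOrder V] [IsOrderedAddMonoid V]
    [DecidableEq ι] (g : V → ℝ)
    (hg : ∀ u v w : V, 0 ≤ u → 0 ≤ v → 0 ≤ w → g (u + w) - g u ≤ g (u + v + w) - g (u + v))
    (v : ι → V) (hv : ∀ i, 0 ≤ v i) (a b : V) (hb : 0 ≤ b) (hab : b ≤ a) (S : Finset ι) :
    ∑ i ∈ S, (g (b + v i) - g b) ≤ g (a + ∑ i ∈ S, v i) - g a := by
  induction S using Finset.induction_on with
  | empty => simp
  | insert j S hj ih =>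
    rw [Finset.sum_insert hj, Finset.sum_insert hj]
    have hS : 0 ≤ ∑ i ∈ S, v i := Finset.sum_nonneg fun i _ => hv i
    have h := hg b (a - b + ∑ i ∈ S, v i) (v j) hb (add_nonneg (sub_nonneg.2 hab) hS) (hv j)
    have e1 : b + (a - b + ∑ i ∈ S, v i) = a + ∑ i ∈ S, v i := by abel
    rw [e1] at h
    have e2 : a + (v j + ∑ i ∈ S, v i) = a + ∑ i ∈ S, v i + v j := by abel
    rw [e2]
    linarith

lemma aux_marg_down {V ι : Type*} [AddCommGroup V] [PartialOrder V] [IsOrderedAddMonoid V]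
    [DecidableEq ι] [Fintype ι] (g : V → ℝ)
    (hg : ∀ u v w : V, 0 ≤ u → 0 ≤ v → 0 ≤ w → g (u + w) - g u ≤ g (u + v + w) - g (u + v))
    (v : ι → V) (hv : ∀ i, 0 ≤ v i) (S : Finset ι) :
    g (∑ i ∈ S, v i) - g 0 ≤ ∑ i ∈ S, (g (∑ j, v j) - g (∑ j, v j - v i)) := by
  induction S using Finset.induction_on with
  | empty => simp
  | insert j S hj ih =>
    rw [Finset.sum_insert hj, Finset.sum_insert hj]
    have hS : 0 ≤ ∑ i ∈ S, v i := Finset.sum_nonneg fun i _ => hv i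
    have hle : v j + ∑ i ∈ S, v i ≤ ∑ i, v i := by
      rw [← Finset.sum_insert hj]
      exact Finset.sum_le_sum_of_subset_of_nonneg (Finset.subset_univ _) fun i _ _ => hv i
    have h := hg (∑ i ∈ S, v i) (∑ i, v i - (v j + ∑ i ∈ S, v i)) (v j) hS
      (sub_nonneg.2 hle) (hv j)
    have e1 : ∑ i ∈ S, v i + (∑ i, v i - (v j + ∑ i ∈ S, v i)) = ∑ i, v i - v j := by abel
    rw [e1, sub_add_cancel] at h
    rw [add_comm (v j)]
    linarith

/-- Lower bound for supermodular approximation of the sum-of-column-maxima norm on m×m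
matrices: if `f` is monotone, subadditive, has supermodular `p`-th power, and
`α`-approximates `N(x) = ∑ₖ maxᵢ |x_{i,k}|`, then `α·p ≥ (ln 2)·m`. -/
theorem sum_linf_no_supermodular_approx (m : ℕ) (hm : 1 ≤ m) (p α : ℝ)
    (hp : 1 ≤ p) (hα : 1 ≤ α)
    (f : (Fin m × Fin m → ℝ) → ℝ)
    (N : (Fin m × Fin m → ℝ) → ℝ)
    (hNdef : ∀ x, N x = ∑ k : Fin m, ⨆ i : Fin m, |x (i, k)|)
    (hf_nonneg : ∀ x : Fin m × Fin m → ℝ, 0 ≤ x → 0 ≤ f x)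
    (hmono : ∀ x y : Fin m × Fin m → ℝ, 0 ≤ x → x ≤ y → f x ≤ f y)
    (hsub : ∀ x y : Fin m × Fin m → ℝ, 0 ≤ x → 0 ≤ y → f (x + y) ≤ f x + f y)
    (hsuper : ∀ u v w : Fin m × Fin m → ℝ, 0 ≤ u → 0 ≤ v → 0 ≤ w →
      f (u + w) ^ p - f u ^ p ≤ f (u + v + w) ^ p - f (u + v) ^ p)
    (happrox : ∀ x : Fin m × Fin m → ℝ, 0 ≤ x → N x ≤ f x ∧ f x ≤ α * N x) :
    Real.log 2 * m ≤ α * p := by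
  classical
  haveI : Nonempty (Fin m) := ⟨⟨0, hm⟩⟩
  have hmR : (0 : ℝ) < m := by exact_mod_cast hm
  set g : (Fin m × Fin m → ℝ) → ℝ := fun x => f x ^ p with hgdef
  let e : Fin m → Fin m → (Fin m × Fin m → ℝ) := fun i k => Pi.single (i, k) 1
  have he : ∀ i k, 0 ≤ e i k := fun i k => Pi.single_nonneg.2 zero_le_one
  let u : (Fin m → Fin m) → (Fin m × Fin m → ℝ) := fun σ => ∑ k, e (σ k) k
  have hu0 : ∀ σ, 0 ≤ u σ := fun σ => Finset.sum_nonneg fun k _ => he _ _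
  have hg0 : g 0 = 0 := by
    have h1 := (happrox 0 le_rfl).2
    have h2 := hf_nonneg 0 le_rfl
    have h3 : N 0 = 0 := by rw [hNdef]; simp
    rw [h3, mul_zero] at h1
    have h4 : f 0 = 0 := le_antisymm h1 h2
    simp only [hgdef, h4]
    exact Real.zero_rpow (by linarith)
  obtain ⟨σ, hσ⟩ := Finite.exists_min (fun σ => g (u σ))
  have hfu : (m : ℝ) ≤ f (u σ) := by
    refine le_trans ?_ (happrox _ (hu0 σ)).1
    rw [hNdef]
    have : ∀ k : Fin m, (1 : ℝ) ≤ ⨆ i : Fin m, |u σ (i, k)| := by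
      intro k
      refine le_trans ?_ (le_ciSup (f := fun i : Fin m => |u σ (i, k)|)
        (Set.finite_range _).bddAbove (σ k))
      refine le_trans ?_ (le_abs_self _)
      have h1 : e (σ k) k ≤ u σ :=
        Finset.single_le_sum (f := fun k => e (σ k) k) (fun k _ => he _ _) (Finset.mem_univ k)
      have h2 := h1 (σ k, k)
      simpa [e] using h2
    calc (m : ℝ) = ∑ k : Fin m, (1 : ℝ) := by simp
      _ ≤ _ := Finset.sum_le_sum fun k _ => this k
  have hdown := aux_marg_down g hsuper (fun k => e (σ k) k) (fun k => he _ _) Finset.univ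
  rw [hg0, sub_zero] at hdown
  obtain ⟨k, -, hk⟩ : ∃ k ∈ (Finset.univ : Finset (Fin m)),
      g (u σ) / m ≤ g (u σ) - g (u σ - e (σ k) k) := by
    apply Finset.exists_le_of_sum_le Finset.univ_nonempty
    refine le_trans (le_of_eq ?_) hdown
    simp only [Finset.sum_const, Finset.card_univ, Fintype.card_fin, nsmul_eq_mul]
    rw [mul_div_cancel₀ _ hmR.ne']
  have hb : 0 ≤ u σ - e (σ k) k := sub_nonneg.2
    (Finset.single_le_sum (f := fun k => e (σ k) k) (fun k _ => he _ _) (Finset.mem_univ k))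
  have hup := aux_marg_up g hsuper (fun i => e i k) (fun i => he _ _) (u σ) (u σ - e (σ k) k) hb
    (sub_le_self _ (he _ _)) Finset.univ
  have hupd : ∀ i, u σ - e (σ k) k + e i k = u (Function.update σ k i) := by
    intro i
    simp only [u]
    rw [← Finset.add_sum_erase _ _ (Finset.mem_univ k),
      ← Finset.add_sum_erase Finset.univ (fun k' => e (Function.update σ k i k') k')
        (Finset.mem_univ k)]
    have : ∑ x ∈ Finset.univ.erase k, e (Function.update σ k i x) x
        = ∑ x ∈ Finset.univ.erase k, e (σ x) x := by
      refine Finset.sum_congr rfl fun x hx => ?_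
      rw [Function.update_of_ne (Finset.ne_of_mem_erase hx)]
    rw [this, Function.update_self]
    abel
  have hlow : g (u σ) ≤ ∑ i : Fin m, (g (u σ - e (σ k) k + e i k) - g (u σ - e (σ k) k)) := by
    calc g (u σ) = ∑ i : Fin m, g (u σ) / m := by
          simp only [Finset.sum_const, Finset.card_univ, Fintype.card_fin, nsmul_eq_mul]
          rw [mul_div_cancel₀ _ hmR.ne']
      _ ≤ _ := by
          refine Finset.sum_le_sum fun i _ => ?_
          have := hσ (Function.update σ k i)
          rw [hupd]
          linarith
  have hc0 : 0 ≤ ∑ i, e i k := Finset.sum_nonneg fun i _ => he _ _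
  have hNc : N (∑ i, e i k) ≤ 1 := by
    rw [hNdef]
    calc _ ≤ ∑ k' : Fin m, (if k' = k then (1 : ℝ) else 0) := by
          refine Finset.sum_le_sum fun k' _ => ciSup_le fun i => ?_
          simp only [Finset.sum_apply, e, Pi.single_apply, Prod.mk.injEq]
          by_cases h : k' = k <;> simp [h]
      _ = 1 := by simp
  have hfc : f (∑ i, e i k) ≤ α :=
    (happrox _ hc0).2.trans (by nlinarith)
  have hsum : f (u σ + ∑ i, e i k) ≤ f (u σ) + α := (hsub _ _ (hu0 σ) hc0).trans (by linarith)
  have hF : 0 < f (u σ) := hmR.trans_le hfu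
  have h2 : 2 * f (u σ) ^ p ≤ (f (u σ) + α) ^ p := by
    have h3 : f (u σ + ∑ i, e i k) ^ p ≤ (f (u σ) + α) ^ p :=
      Real.rpow_le_rpow (hf_nonneg _ (add_nonneg (hu0 σ) hc0)) hsum (by linarith)
    have h4 := hlow.trans hup
    simp only [hgdef] at h4
    linarith
  have h5 : f (u σ) + α ≤ f (u σ) * Real.exp (α / m) := by
    have h6 := Real.add_one_le_exp (α / m)
    have h7 : α ≤ f (u σ) * (α / m) := by
      rw [mul_div_assoc', le_div_iff₀ hmR]
      nlinarith
    nlinarith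
  have h8 : (f (u σ) + α) ^ p ≤ f (u σ) ^ p * Real.exp (α / m * p) := by
    rw [Real.exp_mul, ← Real.mul_rpow hF.le (Real.exp_pos _).le]
    exact Real.rpow_le_rpow (by linarith) h5 (by linarith)
  have h9 : 2 ≤ Real.exp (α / m * p) := by
    have := Real.rpow_pos_of_pos hF p
    nlinarith
  have h10 : Real.log 2 ≤ α / m * p := (Real.log_le_iff_le_exp (by norm_num)).2 h9
  rw [div_mul_eq_mul_div, le_div_iff₀ hmR] at h10
  exact h10
end
end

section
/- Let p ≥ 1 and let G be an Orlicz function that is twice differentiable on [0,∞) and satisfies G″(t)·t ≤ (p−1)·G′(t) for all t ≥ 0. Then for every n ≥ 1 the Orlicz norm ‖·‖_G on ℝⁿ is (2p−1)-supermodular: for all u, v, w ∈ ℝⁿ with nonnegative coordinates, ‖u+v+w‖_G^{2p−1} − ‖u+v‖_G^{2p−1} ≥ ‖u+w‖_G^{2p−1} − ‖u‖_G^{2p−1}. -/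
noncomputable section

/-- An Orlicz function: continuous, convex and nondecreasing on `[0,∞)`, with `G 0 = 0` and
`G(t) → ∞` as `t → ∞`. -/
def IsOrliczFunction (G : ℝ → ℝ) : Prop :=
  ContinuousOn G (Set.Ici 0) ∧ ConvexOn ℝ (Set.Ici 0) G ∧
  MonotoneOn G (Set.Ici 0) ∧ G 0 = 0 ∧
  Filter.Tendsto G Filter.atTop Filter.atTop

/-- The Orlicz norm generated by `G`: `inf {α > 0 : ∑ᵢ G (xᵢ/α) ≤ 1}`. -/
def orliczNorm {n : ℕ} (G : ℝ → ℝ) (x : Fin n → ℝ) : ℝ :=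
  sInf {α : ℝ | 0 < α ∧ ∑ i, G (x i / α) ≤ 1}

/-- Supermodularity from a monotone field of subgradients. -/
theorem supermod_of_subgrad {n : ℕ} (F : (Fin n → ℝ) → ℝ) (E : (Fin n → ℝ) → Fin n → ℝ)
    (hsub : ∀ x x' : Fin n → ℝ, 0 ≤ x → 0 ≤ x' → F x + ∑ i, E x i * (x' i - x i) ≤ F x')
    (hmono : ∀ x x' : Fin n → ℝ, 0 ≤ x → x ≤ x' → ∀ i, E x i ≤ E x' i)
    (u v w : Fin n → ℝ) (hu : 0 ≤ u) (hv : 0 ≤ v) (hw : 0 ≤ w) :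
    F (u + w) - F u ≤ F (u + v + w) - F (u + v) := by
  set d : (Fin n → ℝ) → ℝ := fun x => ∑ i, E x i * w i with hd
  have hdm : ∀ x x' : Fin n → ℝ, 0 ≤ x → x ≤ x' → d x ≤ d x' := fun x x' h h' =>
    Finset.sum_le_sum fun i _ => mul_le_mul_of_nonneg_right (hmono x x' h h' i) (hw i)
  have key : ∀ m : ℕ, 0 < m →
      F (u + w) - F u - (F (u + v + w) - F (u + v)) ≤ (d (u + w) - d u) / m := by
    intro m hm
    have hm' : (0 : ℝ) < m := by exact_mod_cast hm
    have step : ∀ k : ℕ, k ≤ m → F (u + ((k : ℝ) / m) • w) - F u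
        - (F (u + v + ((k : ℝ) / m) • w) - F (u + v)) ≤ (d (u + ((k : ℝ) / m) • w) - d u) / m := by
      intro k
      induction k with
      | zero => intro _; simp
      | succ k ih =>
        intro hk
        have ih := ih (by omega)
        have nn : ∀ j : ℕ, 0 ≤ ((j : ℝ) / m) • w := fun j => smul_nonneg (by positivity) hw
        have h1 := hsub (u + (((k + 1 : ℕ) : ℝ) / m) • w) (u + ((k : ℝ) / m) • w)
          (add_nonneg hu (nn _)) (add_nonneg hu (nn _))
        have h2 := hsub (u + v + ((k : ℝ) / m) • w) (u + v + (((k + 1 : ℕ) : ℝ) / m) • w)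
          (add_nonneg (add_nonneg hu hv) (nn _)) (add_nonneg (add_nonneg hu hv) (nn _))
        have h3 := hdm (u + ((k : ℝ) / m) • w) (u + v + ((k : ℝ) / m) • w)
          (add_nonneg hu (nn _)) (by
            gcongr
            exact le_add_of_nonneg_right hv)
        have e1 : ∑ i, E (u + (((k + 1 : ℕ) : ℝ) / m) • w) i *
            ((u + ((k : ℝ) / m) • w) i - (u + (((k + 1 : ℕ) : ℝ) / m) • w) i)
            = - (d (u + (((k + 1 : ℕ) : ℝ) / m) • w) / m) := by
          rw [hd, Finset.sum_div, ← Finset.sum_neg_distrib]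
          refine Finset.sum_congr rfl fun i _ => ?_
          simp only [Pi.add_apply, Pi.smul_apply, smul_eq_mul]
          push_cast
          ring
        have e2 : ∑ i, E (u + v + ((k : ℝ) / m) • w) i *
            ((u + v + (((k + 1 : ℕ) : ℝ) / m) • w) i - (u + v + ((k : ℝ) / m) • w) i)
            = d (u + v + ((k : ℝ) / m) • w) / m := by
          rw [hd, Finset.sum_div]
          refine Finset.sum_congr rfl fun i _ => ?_
          simp only [Pi.add_apply, Pi.smul_apply, smul_eq_mul]
          push_cast
          ring
        rw [e1] at h1
        rw [e2] at h2
        have h3' := div_le_div_of_nonneg_right h3 hm'.le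
        rw [sub_div] at ih ⊢
        linarith
    have := step m le_rfl
    rw [div_self hm'.ne', one_smul] at this
    exact this
  have lim : Filter.Tendsto (fun m : ℕ => (d (u + w) - d u) / (m : ℝ)) Filter.atTop (nhds 0) :=
    tendsto_const_div_atTop_nhds_zero_nat _
  have := ge_of_tendsto lim (Filter.eventually_atTop.2 ⟨1, fun m hm => key m hm⟩)
  linarith

/-- The analytic facts about `G` that are used. -/
structure Good (a : ℝ) (G g : ℝ → ℝ) : Prop where
  ha : 0 ≤ a
  cont : ContinuousOn G (Set.Ici 0)
  mono : MonotoneOn G (Set.Ici 0)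
  zero : G 0 = 0
  top : Filter.Tendsto G Filter.atTop Filter.atTop
  gnn : ∀ t, 0 ≤ t → 0 ≤ g t
  gpos : ∀ t, 0 < t → 0 < g t
  gmono : MonotoneOn g (Set.Ici 0)
  grad : ∀ s t, 0 ≤ s → 0 ≤ t → G s + g s * (t - s) ≤ G t
  scale : ∀ t r, 0 ≤ t → 1 ≤ r → g t ≤ r ^ a * g (t / r)
  A : MonotoneOn (fun t => t * g t - G t) (Set.Ici 0)
  B : MonotoneOn (fun t => (a + 1) * G t - t * g t) (Set.Ici 0)

theorem good_of (p : ℝ) (hp : 1 ≤ p)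
    (G G' G'' : ℝ → ℝ) (hG : IsOrliczFunction G)
    (hd1 : ∀ t ∈ Set.Ici (0 : ℝ), HasDerivWithinAt G (G' t) (Set.Ici 0) t)
    (hd2 : ∀ t ∈ Set.Ici (0 : ℝ), HasDerivWithinAt G' (G'' t) (Set.Ici 0) t)
    (hgrowth : ∀ t : ℝ, 0 ≤ t → G'' t * t ≤ (p - 1) * G' t) : Good (p - 1) G G' := by
  obtain ⟨hc, hconv, hm, h0, htop⟩ := hG
  have ud : ∀ t ∈ Set.Ici (0:ℝ), UniqueDiffWithinAt ℝ (Set.Ici (0:ℝ)) t :=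
    fun t ht => uniqueDiffOn_Ici 0 t ht
  have dG : ∀ t ∈ Set.Ici (0 : ℝ), derivWithin G (Set.Ici 0) t = G' t :=
    fun t ht => (hd1 t ht).derivWithin (ud t ht)
  have dG' : ∀ t ∈ Set.Ici (0 : ℝ), derivWithin G' (Set.Ici 0) t = G'' t :=
    fun t ht => (hd2 t ht).derivWithin (ud t ht)
  have gnn : ∀ t, 0 ≤ t → 0 ≤ G' t := fun t ht => by
    rw [← dG t ht]; exact hm.derivWithin_nonneg
  have gmono : MonotoneOn G' (Set.Ici 0) := by
    have := hconv.monotoneOn_derivWithin (fun t ht => (hd1 t ht).differentiableWithinAt)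
    intro s hs t ht hst
    have h := this hs ht hst
    rwa [dG s hs, dG t ht] at h
  have g2nn : ∀ t, 0 ≤ t → 0 ≤ G'' t := fun t ht => by
    rw [← dG' t ht]; exact gmono.derivWithin_nonneg
  have D1 : ∀ t, 0 < t → HasDerivAt G (G' t) t := fun t ht =>
    (hd1 t ht.le).hasDerivAt (Ici_mem_nhds ht)
  have D2 : ∀ t, 0 < t → HasDerivAt G' (G'' t) t := fun t ht =>
    (hd2 t ht.le).hasDerivAt (Ici_mem_nhds ht)
  have hc' : ContinuousOn G' (Set.Ici 0) := fun t ht => (hd2 t ht).continuousWithinAt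
  have anti : AntitoneOn (fun t => G' t * t ^ (1 - p)) (Set.Ioi 0) := by
    have hD : ∀ t : ℝ, 0 < t → HasDerivAt (fun t => G' t * t ^ (1 - p))
        (G'' t * t ^ (1 - p) + G' t * ((1 - p) * t ^ (1 - p - 1))) t := fun t ht =>
      (D2 t ht).mul (Real.hasDerivAt_rpow_const (Or.inl ht.ne'))
    apply antitoneOn_of_deriv_nonpos (convex_Ioi 0)
    · exact fun t ht => (hD t ht).continuousAt.continuousWithinAt
    · rw [interior_Ioi]
      exact fun t ht => (hD t ht).differentiableAt.differentiableWithinAt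
    · rw [interior_Ioi]
      intro t ht
      have ht : 0 < t := ht
      rw [(hD t ht).deriv]
      have e : t ^ (1 - p) = t ^ (1 - p - 1) * t := by
        rw [Real.rpow_sub_one ht.ne']; field_simp
      rw [e]
      have := mul_le_mul_of_nonneg_left (hgrowth t ht.le) (Real.rpow_nonneg ht.le (1 - p - 1))
      nlinarith
  have scale : ∀ t r, 0 ≤ t → 1 ≤ r → G' t ≤ r ^ (p - 1) * G' (t / r) := by
    intro t r ht hr
    have hr0 : 0 < r := by linarith
    rcases ht.eq_or_lt with rfl | ht
    · rw [zero_div]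
      exact le_mul_of_one_le_left (gnn 0 le_rfl) (Real.one_le_rpow hr (by linarith))
    · have h := anti (a := t / r) (b := t) (div_pos ht hr0) ht (div_le_self ht.le hr)
      simp only at h
      rw [Real.div_rpow ht.le hr0.le, show (1 - p) = -(p - 1) by ring, Real.rpow_neg hr0.le,
        Real.rpow_neg ht.le] at h
      have hp1 := Real.rpow_pos_of_pos ht (p - 1)
      have hp2 := Real.rpow_pos_of_pos hr0 (p - 1)
      field_simp at h
      linarith
  have grad : ∀ s t, 0 ≤ s → 0 ≤ t → G s + G' s * (t - s) ≤ G t := by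
    intro s t hs ht
    rcases lt_trichotomy s t with h | h | h
    · obtain ⟨c, hc1, hc2⟩ := exists_hasDerivAt_eq_slope G G' h
        (hc.mono fun x hx => hs.trans hx.1) (fun x hx => D1 x (hs.trans_lt hx.1))
      have := gmono (a := s) (b := c) hs (hs.trans hc1.1.le) hc1.1.le
      rw [hc2, le_div_iff₀ (by linarith)] at this
      linarith
    · subst h; simp
    · obtain ⟨c, hc1, hc2⟩ := exists_hasDerivAt_eq_slope G G' h
        (hc.mono fun x hx => ht.trans hx.1) (fun x hx => D1 x (ht.trans_lt hx.1))
      have := gmono (a := c) (b := s) (ht.trans hc1.1.le) hs hc1.2.le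
      rw [hc2, div_le_iff₀ (by linarith)] at this
      linarith
  refine ⟨by linarith, hc, hm, h0, htop, gnn, ?_, gmono, grad, scale, ?_, ?_⟩
  · intro t ht
    by_contra hcon
    have hz : G' t = 0 := le_antisymm (not_lt.1 hcon) (gnn t ht.le)
    have hall : ∀ s, t ≤ s → G s ≤ G t := by
      intro s hs
      have hs0 : 0 < s := ht.trans_le hs
      have h1 := scale s (s / t) hs0.le ((one_le_div ht).2 hs)
      rw [div_div_cancel₀ hs0.ne', hz, mul_zero] at h1
      have h2 : G' s = 0 := le_antisymm h1 (gnn s hs0.le)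
      have := grad s t hs0.le ht.le
      rw [h2] at this
      linarith
    obtain ⟨s, hs1, hs2⟩ := ((htop.eventually_gt_atTop (G t)).and
      (Filter.eventually_ge_atTop t)).exists
    linarith [hall s hs2]
  · have hD : ∀ t : ℝ, 0 < t → HasDerivAt (fun t => t * G' t - G t)
        (1 * G' t + t * G'' t - G' t) t := fun t ht =>
      ((hasDerivAt_id t).mul (D2 t ht)).sub (D1 t ht)
    apply monotoneOn_of_deriv_nonneg (convex_Ici 0)
    · exact (continuousOn_id.mul hc').sub hc
    · rw [interior_Ici]
      exact fun t ht => (hD t ht).differentiableAt.differentiableWithinAt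
    · rw [interior_Ici]
      intro t ht
      have ht : 0 < t := ht
      rw [(hD t ht).deriv]
      nlinarith [mul_nonneg ht.le (g2nn t ht.le)]
  · have hD : ∀ t : ℝ, 0 < t → HasDerivAt (fun t => (p - 1 + 1) * G t - t * G' t)
        ((p - 1 + 1) * G' t - (1 * G' t + t * G'' t)) t := fun t ht =>
      ((D1 t ht).const_mul _).sub ((hasDerivAt_id t).mul (D2 t ht))
    apply monotoneOn_of_deriv_nonneg (convex_Ici 0)
    · exact (continuousOn_const.mul hc).sub (continuousOn_id.mul hc')
    · rw [interior_Ici]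
      exact fun t ht => (hD t ht).differentiableAt.differentiableWithinAt
    · rw [interior_Ici]
      intro t ht
      have ht : 0 < t := ht
      rw [(hD t ht).deriv]
      nlinarith [hgrowth t ht.le]

theorem Good.Gnn {a : ℝ} {G g : ℝ → ℝ} (h : Good a G g) {t : ℝ} (ht : 0 ≤ t) : 0 ≤ G t := by
  have := (@Good.mono _ _ _ h) (a := 0) (b := t) (le_refl (0:ℝ)) ht ht
  rwa [h.zero] at this

theorem Good.strict {a : ℝ} {G g : ℝ → ℝ} (h : Good a G g) {s t : ℝ} (hs : 0 ≤ s) (hst : s < t) :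
    G s < G t := by
  rcases hs.eq_or_lt with rfl | hs
  · have h1 := h.grad (t / 2) t (by linarith) hst.le
    have h2 := h.Gnn (t := t / 2) (by linarith)
    have h3 := h.gpos (t / 2) (by linarith)
    rw [h.zero]
    nlinarith
  · have h1 := h.grad s t hs.le (hs.trans hst).le
    have h3 := h.gpos s hs
    nlinarith

theorem Good.sum_mono {a : ℝ} {G g : ℝ → ℝ} (h : Good a G g) {n : ℕ} {y z : Fin n → ℝ} {r : ℝ}
    (hr : 1 ≤ r) (hy : 0 ≤ y) (hz : 0 ≤ z) (hyz : ∀ i, y i / r ≤ z i)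
    (sy : ∑ i, G (y i) = 1) (sz : ∑ i, G (z i) = 1) :
    ∑ i, g (z i) * z i ≤ r ^ a * ∑ i, g (y i) * y i := by
  have ha := h.ha
  have hr0 : 0 < r := by linarith
  have hinv : 0 ≤ 1 - 1 / r := by
    rw [sub_nonneg, div_le_one hr0]; exact hr
  have term : ∀ i, g (z i) * z i ≤
      (1 + a * (1 - 1 / r)) * (g (y i) * y i) + (a + 1) * (G (z i) - G (y i)) := by
    intro i
    have hyi : 0 ≤ y i := hy i
    have hzi : 0 ≤ z i := hz i
    have hK : 0 ≤ a * ((1 - 1 / r) * (g (y i) * y i)) :=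
      mul_nonneg ha (mul_nonneg hinv (mul_nonneg (h.gnn _ hyi) hyi))
    rcases le_total (y i) (z i) with hle | hle
    · have := (@Good.B _ _ _ h) (a := y i) (b := z i) hyi hzi hle
      simp only at this
      nlinarith
    · have h1 := (@Good.A _ _ _ h) (a := z i) (b := y i) hzi hyi hle
      simp only at h1
      have hyr : 0 ≤ y i / r := div_nonneg hyi hr0.le
      have h2 := h.grad (y i) (y i / r) hyi hyr
      have h3 := (@Good.mono _ _ _ h) (a := y i / r) (b := z i) hyr hzi (hyz i)
      have h4 : G (y i) - G (z i) ≤ (1 - 1 / r) * (g (y i) * y i) := by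
        have : g (y i) * (y i / r - y i) = - ((1 - 1 / r) * (g (y i) * y i)) := by ring
        linarith
      have h5 := mul_le_mul_of_nonneg_left h4 ha
      nlinarith
  have hs := Finset.sum_le_sum fun i (_ : i ∈ Finset.univ) => term i
  rw [Finset.sum_add_distrib, ← Finset.mul_sum, ← Finset.mul_sum, Finset.sum_sub_distrib, sy, sz]
    at hs
  have hS : 0 ≤ ∑ i, g (y i) * y i :=
    Finset.sum_nonneg fun i _ => mul_nonneg (h.gnn _ (hy i)) (hy i)
  have hra : 1 + a * (1 - 1 / r) ≤ r ^ a := by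
    rw [Real.rpow_def_of_pos hr0]
    have h1 := Real.add_one_le_exp (Real.log r * a)
    have h2 := Real.one_sub_inv_le_log_of_pos hr0
    rw [one_div]
    nlinarith
  nlinarith

theorem Good.norm_spec {a : ℝ} {G g : ℝ → ℝ} (h : Good a G g) {n : ℕ} {x : Fin n → ℝ}
    (hx : 0 ≤ x) (hne : x ≠ 0) :
    0 < orliczNorm G x ∧ ∑ i, G (x i / orliczNorm G x) = 1 := by
  obtain ⟨j, hj⟩ : ∃ j, x j ≠ 0 := by
    by_contra hcon
    push Not at hcon
    exact hne (funext hcon)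
  have hj : 0 < x j := lt_of_le_of_ne (hx j) (Ne.symm hj)
  set f : ℝ → ℝ := fun s => ∑ i, G (x i * s) with hf
  have hfc : ContinuousOn f (Set.Ici 0) := by
    apply continuousOn_finset_sum
    intro i _
    exact h.cont.comp (by fun_prop) fun s hs => mul_nonneg (hx i) hs
  have hf0 : f 0 = 0 := by simp [hf, h.zero]
  have hfs : ∀ s t, 0 ≤ s → s < t → f s < f t := by
    intro s t hs hst
    apply Finset.sum_lt_sum
    · intro i _
      exact h.mono (mul_nonneg (hx i) hs) (mul_nonneg (hx i) (hs.trans hst.le))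
        (mul_le_mul_of_nonneg_left hst.le (hx i))
    · exact ⟨j, Finset.mem_univ _, h.strict (mul_nonneg hj.le hs) (mul_lt_mul_of_pos_left hst hj)⟩
  obtain ⟨T, hT1, hT0⟩ := ((h.top.eventually_ge_atTop 1).and (Filter.eventually_ge_atTop 0)).exists
  have hfT : 1 ≤ f (T / x j) := by
    have : G (x j * (T / x j)) ≤ f (T / x j) :=
      Finset.single_le_sum (f := fun i => G (x i * (T / x j)))
        (fun i _ => h.Gnn (mul_nonneg (hx i) (div_nonneg hT0 hj.le))) (Finset.mem_univ j)
    rw [mul_div_cancel₀ _ hj.ne'] at this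
    linarith
  obtain ⟨s, hs, hs1⟩ := intermediate_value_Icc (div_nonneg hT0 hj.le)
    (hfc.mono fun s hs => hs.1) (show (1:ℝ) ∈ Set.Icc (f 0) (f (T / x j)) from
      ⟨by rw [hf0]; norm_num, hfT⟩)
  have hspos : 0 < s := by
    refine lt_of_le_of_ne hs.1 fun he => ?_
    rw [← he, hf0] at hs1
    norm_num at hs1
  have hN : orliczNorm G x = s⁻¹ := by
    have : {α : ℝ | 0 < α ∧ ∑ i, G (x i / α) ≤ 1} = Set.Ici s⁻¹ := by
      ext α
      simp only [Set.mem_setOf_eq, Set.mem_Ici]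
      constructor
      · rintro ⟨h1, h2⟩
        by_contra hlt
        push Not at hlt
        have h3 : s < α⁻¹ := (lt_inv_comm₀ h1 hspos).1 hlt
        have := hfs s α⁻¹ hspos.le h3
        simp only [div_eq_mul_inv] at h2
        rw [hs1] at this
        exact absurd this (not_lt.2 h2)
      · intro h1
        have hα : 0 < α := (inv_pos.2 hspos).trans_le h1
        refine ⟨hα, ?_⟩
        have h3 : α⁻¹ ≤ s := inv_le_of_inv_le₀ hspos h1
        rw [← hs1]
        simp only [div_eq_mul_inv]
        rcases h3.eq_or_lt with he | he
        · rw [he]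
        · exact (hfs _ _ (inv_pos.2 hα).le he).le
    rw [orliczNorm, this, csInf_Ici]
  rw [hN]
  refine ⟨inv_pos.2 hspos, ?_⟩
  simpa [div_eq_mul_inv] using hs1

theorem Good.norm_zero {a : ℝ} {G g : ℝ → ℝ} (h : Good a G g) {n : ℕ} :
    orliczNorm G (0 : Fin n → ℝ) = 0 := by
  have : {α : ℝ | 0 < α ∧ ∑ i, G ((0 : Fin n → ℝ) i / α) ≤ 1} = Set.Ioi 0 := by
    ext α
    simp [h.zero]
  rw [orliczNorm, this, csInf_Ioi]

theorem norm_nn {n : ℕ} (G : ℝ → ℝ) (x : Fin n → ℝ) : 0 ≤ orliczNorm G x :=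
  Real.sInf_nonneg fun _ h => h.1.le

theorem Good.norm_mono {a : ℝ} {G g : ℝ → ℝ} (h : Good a G g) {n : ℕ} {x z : Fin n → ℝ}
    (hx : 0 ≤ x) (hxz : x ≤ z) (hne : z ≠ 0) : orliczNorm G x ≤ orliczNorm G z := by
  have hz := hx.trans hxz
  obtain ⟨h1, h2⟩ := h.norm_spec hz hne
  refine csInf_le ⟨0, fun _ h => h.1.le⟩ ⟨h1, ?_⟩
  rw [← h2]
  refine Finset.sum_le_sum fun i _ => h.mono (div_nonneg (hx i) h1.le) (div_nonneg (hz i) h1.le) ?_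
  exact div_le_div_of_nonneg_right (hxz i) h1.le

/-- The normalising sum in the gradient of the norm. -/
def sgS {n : ℕ} (G g : ℝ → ℝ) (x : Fin n → ℝ) : ℝ :=
  ∑ i, g (x i / orliczNorm G x) * (x i / orliczNorm G x)

/-- The gradient of `N ^ q`. -/
def sgE {n : ℕ} (a : ℝ) (G g : ℝ → ℝ) (x : Fin n → ℝ) (i : Fin n) : ℝ :=
  (2 * a + 1) * orliczNorm G x ^ (2 * a) * (g (x i / orliczNorm G x) / sgS G g x)

theorem Good.sgS_pos {a : ℝ} {G g : ℝ → ℝ} (h : Good a G g) {n : ℕ} {x : Fin n → ℝ}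
    (hx : 0 ≤ x) (hne : x ≠ 0) : 0 < sgS G g x := by
  obtain ⟨h1, h2⟩ := h.norm_spec hx hne
  obtain ⟨j, hj⟩ : ∃ j, x j ≠ 0 := by
    by_contra hcon
    push Not at hcon
    exact hne (funext hcon)
  have hj : 0 < x j := lt_of_le_of_ne (hx j) (Ne.symm hj)
  refine Finset.sum_pos' (fun i _ => ?_) ⟨j, Finset.mem_univ _, ?_⟩
  · have := div_nonneg (hx i) h1.le
    exact mul_nonneg (h.gnn _ this) this
  · have := div_pos hj h1
    exact mul_pos (h.gpos _ this) this

theorem Good.sgE_zero {a : ℝ} {G g : ℝ → ℝ} {n : ℕ} (i : Fin n) :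
    sgE a G g (0 : Fin n → ℝ) i = 0 := by
  simp [sgE, sgS]

theorem Good.sgE_nn {a : ℝ} {G g : ℝ → ℝ} (h : Good a G g) {n : ℕ} {x : Fin n → ℝ}
    (hx : 0 ≤ x) (i : Fin n) : 0 ≤ sgE a G g x i := by
  by_cases hne : x = 0
  · subst hne; rw [Good.sgE_zero]
  have := h.ha
  have h1 := norm_nn G x
  have h2 := h.sgS_pos hx hne
  have h3 := h.gnn _ (div_nonneg (hx i) h1)
  unfold sgE
  positivity

theorem Good.sgE_mono {a : ℝ} {G g : ℝ → ℝ} (h : Good a G g) {n : ℕ} (x z : Fin n → ℝ)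
    (hx : 0 ≤ x) (hxz : x ≤ z) (i : Fin n) : sgE a G g x i ≤ sgE a G g z i := by
  have hz := hx.trans hxz
  by_cases hne : x = 0
  · subst hne; rw [Good.sgE_zero]; exact h.sgE_nn hz i
  have hnz : z ≠ 0 := by
    rintro rfl
    exact hne (le_antisymm hxz hx)
  have ha := h.ha
  obtain ⟨hN, hN1⟩ := h.norm_spec hx hne
  obtain ⟨hM, hM1⟩ := h.norm_spec hz hnz
  have hNM := h.norm_mono hx hxz hnz
  have hS := h.sgS_pos hx hne
  have hT := h.sgS_pos hz hnz
  unfold sgE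
  set S := sgS G g x with hSd
  set T := sgS G g z with hTd
  set N := orliczNorm G x with hNd
  set M := orliczNorm G z with hMd
  have hr : 1 ≤ M / N := (one_le_div hN).2 hNM
  have hyz : ∀ i, x i / N / (M / N) ≤ z i / M := fun i => by
    rw [div_div_div_cancel_right₀ hN.ne']
    exact div_le_div_of_nonneg_right (hxz i) hM.le
  have k1 : T ≤ (M / N) ^ a * S :=
    h.sum_mono hr (y := fun i => x i / N) (z := fun i => z i / M)
      (fun i => div_nonneg (hx i) hN.le) (fun i => div_nonneg (hz i) hM.le) hyz hN1 hM1
  have k2 : g (x i / N) ≤ (M / N) ^ a * g (z i / M) := by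
    refine (h.scale _ _ (div_nonneg (hx i) hN.le) hr).trans ?_
    refine mul_le_mul_of_nonneg_left ?_ (by positivity)
    refine h.gmono ?_ (div_nonneg (hz i) hM.le) (hyz i)
    exact div_nonneg (div_nonneg (hx i) hN.le) (by positivity)
  have k3 : M ^ (2 * a) = N ^ (2 * a) * ((M / N) ^ a * (M / N) ^ a) := by
    rw [← Real.rpow_add (by positivity), ← two_mul, ← Real.mul_rpow hN.le (by positivity),
      mul_div_cancel₀ _ hN.ne']
  rw [mul_assoc, mul_assoc]
  refine mul_le_mul_of_nonneg_left ?_ (by linarith)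
  rw [k3, mul_assoc]
  refine mul_le_mul_of_nonneg_left ?_ (by positivity)
  rw [← mul_div_assoc, div_le_div_iff₀ hS hT]
  have hg : 0 ≤ g (z i / M) := h.gnn _ (div_nonneg (hz i) hM.le)
  calc g (x i / N) * T ≤ ((M / N) ^ a * g (z i / M)) * ((M / N) ^ a * S) := by
        apply mul_le_mul k2 k1 hT.le (by positivity)
    _ = _ := by ring

theorem Good.sgE_sub {a : ℝ} {G g : ℝ → ℝ} (h : Good a G g) {n : ℕ} (x z : Fin n → ℝ)
    (hx : 0 ≤ x) (hz : 0 ≤ z) :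
    orliczNorm G x ^ (2 * a + 1) + ∑ i, sgE a G g x i * (z i - x i)
      ≤ orliczNorm G z ^ (2 * a + 1) := by
  have ha := h.ha
  by_cases hne : x = 0
  · subst hne
    simp only [Good.sgE_zero, zero_mul, Finset.sum_const_zero, add_zero, h.norm_zero]
    rw [Real.zero_rpow (by linarith)]
    exact Real.rpow_nonneg (norm_nn _ _) _
  obtain ⟨hN, hN1⟩ := h.norm_spec hx hne
  have hS := h.sgS_pos hx hne
  have hMnn := norm_nn G z
  have key : ∑ i, g (x i / orliczNorm G x) * z i ≤ orliczNorm G z * sgS G g x := by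
    by_cases hnz : z = 0
    · subst hnz
      simp [h.norm_zero]
    obtain ⟨hM, hM1⟩ := h.norm_spec hz hnz
    have := Finset.sum_le_sum fun i (_ : i ∈ Finset.univ) =>
      h.grad (x i / orliczNorm G x) (z i / orliczNorm G z)
        (div_nonneg (hx i) hN.le) (div_nonneg (hz i) hM.le)
    rw [Finset.sum_add_distrib, hN1, hM1] at this
    simp only [mul_sub] at this
    rw [Finset.sum_sub_distrib] at this
    have e : ∑ i, g (x i / orliczNorm G x) * (z i / orliczNorm G z)
        = (∑ i, g (x i / orliczNorm G x) * z i) / orliczNorm G z := by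
      rw [Finset.sum_div]
      exact Finset.sum_congr rfl fun i _ => by ring
    have h2 : (∑ i, g (x i / orliczNorm G x) * z i) / orliczNorm G z ≤ sgS G g x := by
      rw [← e]; unfold sgS; linarith
    rw [div_le_iff₀ hM] at h2
    linarith
  have hxx : ∑ i, g (x i / orliczNorm G x) * x i = orliczNorm G x * sgS G g x := by
    unfold sgS
    rw [Finset.mul_sum]
    exact Finset.sum_congr rfl fun i _ => by field_simp
  have hsum : ∑ i, sgE a G g x i * (z i - x i) =
      (2 * a + 1) * orliczNorm G x ^ (2 * a) * ((∑ i, g (x i / orliczNorm G x) * z i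
        - ∑ i, g (x i / orliczNorm G x) * x i) / sgS G g x) := by
    rw [← Finset.sum_sub_distrib, Finset.sum_div, Finset.mul_sum]
    exact Finset.sum_congr rfl fun i _ => by unfold sgE; ring
  rw [hsum, hxx]
  set S := sgS G g x
  set N := orliczNorm G x
  set M := orliczNorm G z
  have h1 : (∑ i, g (x i / N) * z i - N * S) / S ≤ M - N := by
    rw [div_le_iff₀ hS]; linarith
  have h2 : (2 * a + 1) * N ^ (2 * a) * ((∑ i, g (x i / N) * z i - N * S) / S)
      ≤ (2 * a + 1) * N ^ (2 * a) * (M - N) :=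
    mul_le_mul_of_nonneg_left h1 (by positivity)
  have h3 : N ^ (2 * a + 1) + (2 * a + 1) * N ^ (2 * a) * (M - N) ≤ M ^ (2 * a + 1) := by
    have hb := one_add_mul_self_le_rpow_one_add (s := M / N - 1) (p := 2 * a + 1)
      (by have : 0 ≤ M / N := by positivity
          linarith) (by linarith)
    rw [add_sub_cancel, Real.div_rpow hMnn hN.le, le_div_iff₀ (by positivity)] at hb
    have e : N ^ (2 * a + 1) = N ^ (2 * a) * N := by rw [Real.rpow_add_one hN.ne']
    calc _ = (1 + (2 * a + 1) * (M / N - 1)) * N ^ (2 * a + 1) := by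
          rw [e]; field_simp
      _ ≤ _ := hb
  linarith

/-- If a twice differentiable Orlicz function satisfies the growth condition
`G″(t)·t ≤ (p−1)·G′(t)` on `[0,∞)`, then the Orlicz norm `‖·‖_G` is `(2p−1)`-supermodular. -/
theorem orliczNorm_pSupermodular_of_growth (p : ℝ) (hp : 1 ≤ p)
    (G G' G'' : ℝ → ℝ) (hG : IsOrliczFunction G)
    (hd1 : ∀ t ∈ Set.Ici (0 : ℝ), HasDerivWithinAt G (G' t) (Set.Ici 0) t)
    (hd2 : ∀ t ∈ Set.Ici (0 : ℝ), HasDerivWithinAt G' (G'' t) (Set.Ici 0) t)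
    (hgrowth : ∀ t : ℝ, 0 ≤ t → G'' t * t ≤ (p - 1) * G' t)
    (n : ℕ) (hn : 1 ≤ n) :
    ∀ u v w : Fin n → ℝ, 0 ≤ u → 0 ≤ v → 0 ≤ w →
      orliczNorm G (u + w) ^ (2 * p - 1) - orliczNorm G u ^ (2 * p - 1) ≤
        orliczNorm G (u + v + w) ^ (2 * p - 1) - orliczNorm G (u + v) ^ (2 * p - 1) := by
  have h := good_of p hp G G' G'' hG hd1 hd2 hgrowth
  intro u v w hu hv hw
  rw [show 2 * p - 1 = 2 * (p - 1) + 1 by ring]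
  exact supermod_of_subgrad (fun x => orliczNorm G x ^ (2 * (p - 1) + 1)) (sgE (p - 1) G G')
    h.sgE_sub h.sgE_mono u v w hu hv hw
end
end
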